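/- arXiv:1108.2925 — 2 statements merged into one kernel-verified Lean document; each statement's English description precedes it below -/
import Mathlib

section
/- Let n ≥ 2. There exist finitely many polynomials g_1,…,g_N ∈ ℚ[y_1,…,y_{n−1}] with the following property: for all real numbers a_1,…,a_n, setting f(t) = ∏_{i=1}^n (t − a_i), (a) the derivative f′ splits over ℝ, i.e. there exists c ∈ ℝ^{n−1} with f′(t) = n·∏_{j=1}^{n−1}(t − c_j) as polynomials in t; and (b) for every such c, ∏_{1≤j<k≤n−1}(c_j − c_k)² = Σ_{m=1}^N g_m(a_n − a_1, a_n − a_2, …, a_n − a_{n−1})². (Thus the discriminant of the derivative of a real-rooted univariate polynomial is a sum of squares of polynomials with rational coefficients in the differences of the roots — the Sottile–Mukhin conjecture.) -/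
open Polynomial Matrix

/-- A form of the Cauchy–Binet formula, summing over all index functions. -/
theorem Matrix.factorial_mul_det_transpose_mul_self {ι κ R : Type*} [Fintype ι] [Fintype κ]
    [DecidableEq κ] [CommRing R] (M : Matrix ι κ R) :
    ((Fintype.card κ).factorial : R) * (Mᵀ * M).det =
      ∑ f : κ → ι, (M.submatrix f id).det ^ 2 := by
  have hdet : (Mᵀ * M).det = ∑ f : κ → ι, (∏ i, M (f i) i) * (M.submatrix f id).det := by
    rw [← det_transpose]
    simp_rw [← det_transpose (M.submatrix _ id)]
    simp only [det_apply', transpose_apply, mul_apply, submatrix_apply, id, Finset.mul_sum,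
      Finset.prod_univ_sum, Fintype.piFinset_univ, Finset.prod_mul_distrib]
    rw [Finset.sum_comm]
    exact Finset.sum_congr rfl fun f _ => Finset.sum_congr rfl fun σ _ => by ring
  have hperm (σ : Equiv.Perm κ) : ∑ f : κ → ι,
      ((Equiv.Perm.sign σ : ℤ) : R) * (∏ i, M (f (σ i)) i) * (M.submatrix f id).det =
        (Mᵀ * M).det := by
    rw [hdet]
    refine Fintype.sum_equiv (σ.symm.arrowCongr (Equiv.refl ι)) _ (fun f : κ → ι =>
      (∏ i, M (f i) i) * (M.submatrix f id).det) fun f => ?_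
    have hcomp : σ.symm.arrowCongr (Equiv.refl ι) f = f ∘ σ := rfl
    have h : (M.submatrix (f ∘ σ) id).det = _ := det_permute σ (M.submatrix f id)
    rw [hcomp, h]
    simp only [Function.comp_apply]
    ring
  calc _ = ∑ σ : Equiv.Perm κ, (Mᵀ * M).det := by
        simp [Fintype.card_perm]
    _ = _ := by
        rw [← Finset.sum_congr rfl fun σ _ => hperm σ, Finset.sum_comm]
        refine Finset.sum_congr rfl fun f _ => ?_
        rw [← Finset.sum_mul, sq]
        simp [det_apply']

theorem Matrix.IsHermitian.trace_pow_eq_sum_eigenvalues {ι : Type*} [Fintype ι] [DecidableEq ι]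
    {A : Matrix ι ι ℝ} (hA : A.IsHermitian) (k : ℕ) :
    (A ^ k).trace = ∑ i, hA.eigenvalues i ^ k := by
  conv_lhs => rw [hA.spectral_theorem, ← map_pow, Unitary.conjStarAlgAut_apply, trace_mul_cycle]
  simp [diagonal_pow, trace_diagonal]

/-- The orthogonal projection onto the complement of the all-ones vector. -/
def centering (n : ℕ) (R : Type*) [CommRing R] [Algebra ℚ R] : Matrix (Fin n) (Fin n) R :=
  1 - of fun _ _ => algebraMap ℚ R (1 / n)

/-- The compression of a diagonal matrix to the complement of the all-ones vector. -/
def compression {n : ℕ} {R : Type*} [CommRing R] [Algebra ℚ R] (b : Fin n → R) :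
    Matrix (Fin n) (Fin n) R :=
  centering n R * diagonal b * centering n R

/-- The matrix whose columns are the entries of the powers of `compression b`. -/
def powerColumns {n : ℕ} {R : Type*} [CommRing R] [Algebra ℚ R] (b : Fin n → R) (m : ℕ) :
    Matrix (Fin n × Fin n) (Fin m) R :=
  of fun p k => (centering n R * compression b ^ (k : ℕ)) p.1 p.2

section

variable {n : ℕ} {R S : Type*} [CommRing R] [Algebra ℚ R] [CommRing S] [Algebra ℚ S]

theorem centering_map (φ : R →ₐ[ℚ] S) : (centering n R).map φ = centering n S := by
  ext i j
  by_cases h : i = j <;> simp [centering, h]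

theorem compression_map (φ : R →ₐ[ℚ] S) (b : Fin n → R) :
    (compression b).map φ = compression (φ ∘ b) := by
  rw [compression, Matrix.map_mul, Matrix.map_mul, centering_map, diagonal_map (map_zero φ)]
  rfl

theorem powerColumns_map (φ : R →ₐ[ℚ] S) (b : Fin n → R) (m : ℕ) :
    (powerColumns b m).map φ = powerColumns (φ ∘ b) m := by
  ext p k
  have h : (centering n R * compression b ^ (k : ℕ)).map φ =
      centering n S * compression (φ ∘ b) ^ (k : ℕ) := by
    rw [← centering_map φ, ← compression_map φ]
    exact (map_mul φ.mapMatrix _ _).trans (congrArg _ (map_pow φ.mapMatrix _ _))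
  exact congr_fun (congr_fun h p.1) p.2

theorem centering_transpose : (centering n R)ᵀ = centering n R := by
  ext i j
  simp [centering, one_apply, eq_comm]

theorem centering_mul_self (hn : n ≠ 0) : centering n R * centering n R = centering n R := by
  have h : (of fun _ _ => algebraMap ℚ R (1 / n) : Matrix (Fin n) (Fin n) R) *
      (of fun _ _ => algebraMap ℚ R (1 / n)) = of fun _ _ => algebraMap ℚ R (1 / n) := by
    ext i j
    have : (n : R) = algebraMap ℚ R n := by simp
    simp only [mul_apply, of_apply, Finset.sum_const, Finset.card_univ, Fintype.card_fin,
      nsmul_eq_mul]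
    rw [this, ← map_mul, ← map_mul]
    congr 1
    field_simp
  rw [centering, sub_mul, mul_sub, mul_sub, h]
  simp

theorem trace_centering (hn : n ≠ 0) : (centering n R).trace = n - 1 := by
  have : (n : R) = algebraMap ℚ R n := by simp
  simp only [centering, trace_sub, trace_one, Fintype.card_fin]
  simp only [trace, diag_apply, of_apply, Finset.sum_const, Finset.card_univ, Fintype.card_fin,
      nsmul_eq_mul]
  rw [this, ← map_mul, mul_one_div_cancel (by exact_mod_cast hn), map_one]

theorem compression_transpose (b : Fin n → R) : (compression b)ᵀ = compression b := by
  simp [compression, centering_transpose, Matrix.mul_assoc]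

theorem centering_mul_compression (hn : n ≠ 0) (b : Fin n → R) :
    centering n R * compression b = compression b := by
  simp only [compression, ← Matrix.mul_assoc, centering_mul_self hn]

theorem compression_mul_centering (hn : n ≠ 0) (b : Fin n → R) :
    compression b * centering n R = compression b := by
  simp only [compression, Matrix.mul_assoc, centering_mul_self hn]

theorem powerColumns_gram (hn : n ≠ 0) (b : Fin n → R) (m : ℕ) (i j : Fin m) :
    ((powerColumns b m)ᵀ * powerColumns b m) i j =
      (centering n R * compression b ^ (i + j : ℕ)).trace := by
  have hcomm : Commute (centering n R) (compression b) :=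
    (centering_mul_compression hn b).trans (compression_mul_centering hn b).symm
  have ht : (centering n R * compression b ^ (i : ℕ))ᵀ =
      centering n R * compression b ^ (i : ℕ) := by
    rw [transpose_mul, transpose_pow, compression_transpose, centering_transpose]
    exact (hcomm.pow_right _).symm
  have h : centering n R * compression b ^ (i + j : ℕ) =
      (centering n R * compression b ^ (i : ℕ))ᵀ * (centering n R * compression b ^ (j : ℕ)) := by
    rw [ht, (hcomm.pow_right (i : ℕ)).eq, Matrix.mul_assoc,
      ← Matrix.mul_assoc (centering n R), centering_mul_self hn, ← Matrix.mul_assoc,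
      ← (hcomm.pow_right (i : ℕ)).eq, Matrix.mul_assoc, pow_add]
  rw [h, trace]
  simp only [diag_apply, mul_apply', powerColumns]
  simp only [dotProduct, transpose_apply, of_apply]
  rw [Fintype.sum_prod_type, Finset.sum_comm]
  rfl

end

theorem compression_isHermitian {n : ℕ} (b : Fin n → ℝ) : (compression b).IsHermitian := by
  rw [IsHermitian, conjTranspose_eq_transpose_of_trivial, compression_transpose]

theorem natCast_mul_charpoly_compression {n : ℕ} (hn : n ≠ 0) (b : Fin n → ℝ) :
    C (n : ℝ) * (compression b).charpoly =
      X * derivative (∏ i, (X - C (b i))) := by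
  refine eq_of_infinite_eval_eq _ _ ((Set.finite_range b).infinite_compl.mono fun t ht => ?_)
  have hne (i : Fin n) : t - b i ≠ 0 := fun h => ht ⟨i, by linarith⟩
  have hn' : (n : ℝ) ≠ 0 := by exact_mod_cast hn
  have hchar : (compression b).charpoly = (diagonal b * centering n ℝ).charpoly := by
    rw [compression, charpoly_mul_comm, ← Matrix.mul_assoc, centering_mul_self hn,
      charpoly_mul_comm]
  have hmat : scalar (Fin n) t - diagonal b * centering n ℝ =
      diagonal (fun i => t - b i) +
        replicateCol Unit (fun i => b i / n) * replicateRow Unit (fun _ => (1 : ℝ)) := by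
    ext i j
    by_cases h : i = j
    · subst h
      simp [centering, mul_apply, diagonal_apply]
      ring
    · simp [centering, mul_apply, diagonal_apply, h]
      ring
  have hunit : IsUnit (diagonal (fun i => t - b i)).det := by
    rw [det_diagonal]
    exact (Finset.prod_ne_zero_iff.mpr fun i _ => hne i).isUnit
  have hinv : (diagonal (fun i => t - b i))⁻¹ = diagonal (fun i => (t - b i)⁻¹) := by
    refine inv_eq_right_inv ?_
    rw [diagonal_mul_diagonal, ← diagonal_one]
    congr 1
    ext i
    exact mul_inv_cancel₀ (hne i)
  have hderiv : (derivative (∏ i, (X - C (b i)))).eval t =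
      (∏ i, (t - b i)) * ∑ i, (t - b i)⁻¹ := by
    rw [derivative_prod_finset, eval_finsetSum, Finset.mul_sum]
    refine Finset.sum_congr rfl fun i _ => ?_
    rw [← Finset.mul_prod_erase _ _ (Finset.mem_univ i)]
    simp only [derivative_X_sub_C, mul_one, eval_prod, eval_sub, eval_X, eval_C]
    field_simp [hne i]
  have hsum : (n : ℝ) * (1 + ∑ i, (t - b i)⁻¹ * (b i / n)) = t * ∑ i, (t - b i)⁻¹ := by
    have : (n : ℝ) = ∑ i : Fin n, (1 : ℝ) := by simp
    rw [mul_add, mul_one, Finset.mul_sum, Finset.mul_sum]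
    nth_rw 1 [this]
    rw [← Finset.sum_add_distrib]
    refine Finset.sum_congr rfl fun i _ => ?_
    field_simp [hne i]
    ring
  simp only [Set.mem_ofPred_eq, eval_mul, eval_C, eval_X]
  rw [hderiv, hchar, eval_charpoly, hmat, det_add_replicateCol_mul_replicateRow hunit, hinv,
    det_diagonal]
  have hone : (1 + replicateRow Unit (fun _ : Fin n => (1 : ℝ)) * diagonal (fun i => (t - b i)⁻¹) *
      replicateCol Unit (fun i => b i / n)).det = 1 + ∑ i, (t - b i)⁻¹ * (b i / n) := by
    simp [det_unique, mul_apply, diagonal_apply]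
  rw [hone]
  linear_combination (∏ i, (t - b i)) * hsum

theorem Polynomial.exists_derivative_prod_X_sub_C_eq {n : ℕ} (hn : n ≠ 0) (a : Fin n → ℝ) :
    ∃ c : Fin (n - 1) → ℝ, derivative (∏ i, (X - C (a i))) =
      C (n : ℝ) * ∏ j, (X - C (c j)) := by
  have hn' : (n : ℝ) ≠ 0 := by exact_mod_cast hn
  have hchar := natCast_mul_charpoly_compression hn a
  set f' := derivative (∏ i, (X - C (a i)))
  have hmonic := charpoly_monic (compression a)
  have hlead : f'.leadingCoeff = n := by
    have := congrArg leadingCoeff hchar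
    rw [leadingCoeff_mul, leadingCoeff_C, hmonic.leadingCoeff, leadingCoeff_mul, leadingCoeff_X,
      mul_one, one_mul] at this
    exact this.symm
  have hne : f' ≠ 0 := leadingCoeff_ne_zero.mp (hlead ▸ hn')
  have hdeg : f'.natDegree = n - 1 := by
    have := congrArg natDegree hchar
    rw [natDegree_C_mul hn', charpoly_natDegree_eq_dim, Fintype.card_fin, natDegree_X_mul hne]
      at this
    omega
  have hsplits : f'.Splits :=
    ((Splits.C (n : ℝ)).mul (compression_isHermitian a).splits_charpoly).of_dvd
      (mul_ne_zero (C_ne_zero.mpr hn') hmonic.ne_zero) (hchar ▸ dvd_mul_left _ _)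
  have hcard : f'.roots.toList.length = n - 1 := by
    rw [Multiset.length_toList, ← hsplits.natDegree_eq_card_roots, hdeg]
  refine ⟨fun j => f'.roots.toList.get (j.cast hcard.symm), ?_⟩
  conv_lhs => rw [hsplits.eq_prod_roots, hlead, ← f'.roots.coe_toList]
  rw [Multiset.map_coe, Multiset.prod_coe, ← Fin.prod_univ_fun_getElem]
  congr 1
  exact (Fintype.prod_equiv (finCongr hcard.symm) _ _ fun _ => rfl).symm

theorem det_gram_powerColumns {n : ℕ} (hn : n ≠ 0) (b : Fin n → ℝ) (d : Fin (n - 1) → ℝ)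
    (h : derivative (∏ i, (X - C (b i))) = C (n : ℝ) * ∏ j, (X - C (d j))) :
    ((powerColumns b (n - 1))ᵀ * powerColumns b (n - 1)).det =
      ∏ p ∈ Finset.univ.filter (fun p : Fin (n - 1) × Fin (n - 1) => p.1 < p.2),
        (d p.1 - d p.2) ^ 2 := by
  have hn' : (n : ℝ) ≠ 0 := by exact_mod_cast hn
  have hchar : (compression b).charpoly = X * ∏ j, (X - C (d j)) := by
    have := natCast_mul_charpoly_compression hn b
    rw [h, mul_left_comm] at this
    exact mul_left_cancel₀ (C_ne_zero.mpr hn') this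
  have hroots : Finset.univ.val.map (compression_isHermitian b).eigenvalues =
      0 ::ₘ Finset.univ.val.map d := by
    have h1 := (compression_isHermitian b).roots_charpoly_eq_eigenvalues
    rw [hchar, roots_mul (mul_ne_zero X_ne_zero
      (Finset.prod_ne_zero_iff.mpr fun j _ => X_sub_C_ne_zero _)), roots_X,
      roots_prod _ _ (Finset.prod_ne_zero_iff.mpr fun j _ => X_sub_C_ne_zero _)] at h1
    simp only [roots_X_sub_C, Multiset.bind_singleton, Multiset.singleton_add] at h1
    exact h1.symm
  have htrace (k : ℕ) : (centering n ℝ * compression b ^ k).trace = ∑ j, d j ^ k := by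
    rcases k with _ | k
    · simp [trace_centering hn, Nat.cast_sub (Nat.one_le_iff_ne_zero.mpr hn)]
    · rw [pow_succ', ← Matrix.mul_assoc, centering_mul_compression hn, ← pow_succ',
        (compression_isHermitian b).trace_pow_eq_sum_eigenvalues]
      have := congrArg (fun s => (s.map (· ^ (k + 1))).sum) hroots
      simpa only [Finset.sum, Function.comp_def, Multiset.map_map, Multiset.map_cons,
        Multiset.sum_cons, zero_pow k.succ_ne_zero, zero_add] using this
  have hgram : (powerColumns b (n - 1))ᵀ * powerColumns b (n - 1) =
      (vandermonde d)ᵀ * vandermonde d := by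
    ext i j
    rw [powerColumns_gram hn, htrace, vandermonde_transpose_mul_vandermonde]
  rw [hgram, det_mul, det_transpose, det_vandermonde, ← Finset.prod_mul_distrib,
    Finset.prod_filter, Fintype.prod_prod_type]
  refine Finset.prod_congr rfl fun i _ => ?_
  rw [← Finset.prod_mul_distrib, ← Finset.prod_filter]
  refine Finset.prod_congr (by ext; simp) fun j _ => by ring

/-- Sottile–Mukhin conjecture: the discriminant of the derivative of a real-rooted monic
polynomial `f(t) = ∏(t − aᵢ)` is a sum of squares of rational polynomials in the root
differences `aₙ − a₁, …, aₙ − a_{n−1}`. -/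
theorem stmt_6 (n : ℕ) (hn : 2 ≤ n) :
    ∃ (N : ℕ) (g : Fin N → MvPolynomial (Fin (n - 1)) ℚ),
      ∀ a : Fin n → ℝ,
        (∃ c : Fin (n - 1) → ℝ,
          Polynomial.derivative (∏ i : Fin n, (Polynomial.X - Polynomial.C (a i))) =
            Polynomial.C (n : ℝ) * ∏ j : Fin (n - 1), (Polynomial.X - Polynomial.C (c j))) ∧
        (∀ c : Fin (n - 1) → ℝ,
          Polynomial.derivative (∏ i : Fin n, (Polynomial.X - Polynomial.C (a i))) =
            Polynomial.C (n : ℝ) * ∏ j : Fin (n - 1), (Polynomial.X - Polynomial.C (c j)) →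
          ∏ p ∈ Finset.univ.filter (fun p : Fin (n - 1) × Fin (n - 1) => p.1 < p.2),
              (c p.1 - c p.2) ^ 2 =
            ∑ m : Fin N,
              (MvPolynomial.aeval
                (fun i : Fin (n - 1) => a ⟨n - 1, by omega⟩ - a (Fin.castLE (by omega) i))
                (g m)) ^ 2) := by
  have hn0 : n ≠ 0 := by omega
  let y : Fin n → MvPolynomial (Fin (n - 1)) ℚ := fun i =>
    if hi : (i : ℕ) < n - 1 then -MvPolynomial.X ⟨i, hi⟩ else 0
  let I := Fin (n - 1).factorial × (Fin (n - 1) → Fin n × Fin n)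
  let G : I → MvPolynomial (Fin (n - 1)) ℚ := fun p =>
    MvPolynomial.C (1 / ((n - 1).factorial : ℚ)) *
      ((powerColumns y (n - 1)).submatrix p.2 id).det
  refine ⟨Fintype.card I, G ∘ (Fintype.equivFin I).symm, fun a =>
    ⟨exists_derivative_prod_X_sub_C_eq hn0 a, fun c hc => ?_⟩⟩
  refine Eq.trans ?_ (Equiv.sum_comp (Fintype.equivFin I).symm fun p => (MvPolynomial.aeval
    (fun i : Fin (n - 1) => a ⟨n - 1, by omega⟩ - a (Fin.castLE (by omega) i)) (G p)) ^ 2).symm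
  set s := a ⟨n - 1, by omega⟩ with hs
  set φ : MvPolynomial (Fin (n - 1)) ℚ →ₐ[ℚ] ℝ :=
    MvPolynomial.aeval (fun i : Fin (n - 1) => s - a (Fin.castLE (by omega) i)) with hφ
  have hy : φ ∘ y = fun i => a i - s := by
    ext i
    by_cases hi : (i : ℕ) < n - 1
    · simp [y, hi, hφ]
    · have : i = ⟨n - 1, by omega⟩ := Fin.ext (by have := i.2; simp only; omega)
      simp [y, hs, this]
  have hshift : derivative (∏ i, (X - C (a i - s))) =
      C (n : ℝ) * ∏ j, (X - C (c j - s)) := by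
    have h := congrArg (fun p => p.comp (X + C s)) hc
    have h2 : (derivative (∏ i, (X - C (a i)))).comp (X + C s) =
        derivative ((∏ i, (X - C (a i))).comp (X + C s)) := by
      simp [derivative_comp]
    simp only [h2] at h
    simp only [mul_comp, prod_comp, sub_comp, X_comp, C_comp] at h
    have hX (x : ℝ) : X - C (x - s) = X + C s - C x := by
      rw [C_sub]
      ring
    simpa only [hX] using h
  have hdet := det_gram_powerColumns hn0 _ _ hshift
  simp only [sub_sub_sub_cancel_right] at hdet
  have hCB := (powerColumns (fun i => a i - s) (n - 1)).factorial_mul_det_transpose_mul_self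
  rw [hdet, Fintype.card_fin] at hCB
  have hG (p : I) : φ (G p) = 1 / ((n - 1).factorial : ℝ) *
      ((powerColumns (fun i => a i - s) (n - 1)).submatrix p.2 id).det := by
    rw [← hy, ← powerColumns_map]
    simp only [G, map_mul, AlgHom.map_det, MvPolynomial.algHom_C]
    simp [AlgHom.mapMatrix_apply, submatrix_map]
  have hfac : ((n - 1).factorial : ℝ) ≠ 0 := by exact_mod_cast (n - 1).factorial_ne_zero
  simp only [hG, mul_pow, I, Fintype.sum_prod_type, Finset.sum_const, Finset.card_univ,
    Fintype.card_fin, nsmul_eq_mul, ← Finset.mul_sum, ← hCB]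
  field_simp
end

section
/- Let A be a real d×n matrix of rank d with no zero columns. Then the Möbius invariant satisfies μ(A) = |μ(∅,{1,…,n})| ≤ binomial(n−1, d−1), with equality if and only if every d columns of A are linearly independent (i.e., the matroid of A is the uniform matroid U_{d,n}). -/
open scoped Classical

/-- The `j`-th column of `A`. -/
def matCol {d n : ℕ} (A : Matrix (Fin d) (Fin n) ℝ) (j : Fin n) : Fin d → ℝ :=
  fun i => A i j

/-- `J` is a flat of `A` if `J = {i : Aᵢ ∈ span{Aⱼ : j ∈ J}}`. -/
def IsFlat {d n : ℕ} (A : Matrix (Fin d) (Fin n) ℝ) (J : Finset (Fin n)) : Prop :=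
  ∀ i : Fin n, i ∈ J ↔ matCol A i ∈ Submodule.span ℝ (matCol A '' ↑J)

/-- The signed count of the subsets of `E` whose vectors span the whole space together
with `W`. -/
noncomputable def signedSpanningCount {ι V : Type*} [AddCommGroup V] [Module ℝ V]
    (v : ι → V) (E : Finset ι) (W : Submodule ℝ V) : ℤ :=
  ∑ X ∈ E.powerset, if Submodule.span ℝ (v '' ↑X) ⊔ W = ⊤ then (-1) ^ X.card else 0

/-- The number of compositions of `n` into `c` positive parts. -/
def compositionCount : ℕ → ℕ → ℕ
  | 0, 0 => 1
  | 0, _ + 1 => 0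
  | _ + 1, 0 => 0
  | n + 1, c + 1 => n.choose c

theorem compositionCount_succ_succ (n c : ℕ) :
    compositionCount (n + 1) (c + 1) = compositionCount n (c + 1) + compositionCount n c := by
  rcases n with _ | n <;> rcases c with _ | c <;>
    simp [compositionCount, Nat.choose_succ_succ, add_comm]

section Spanning

variable {ι V : Type*} [AddCommGroup V] [Module ℝ V]

theorem span_image_insert_sup (v : ι → V) (e : ι) (X : Finset ι) (W : Submodule ℝ V) :
    Submodule.span ℝ (v '' ↑(insert e X)) ⊔ W =
      Submodule.span ℝ (v '' ↑X) ⊔ (W ⊔ Submodule.span ℝ {v e}) := by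
  rw [Finset.coe_insert, Set.image_insert_eq, Submodule.span_insert, sup_assoc, sup_comm,
    sup_assoc]

theorem signedSpanningCount_insert (v : ι → V) {e : ι} {E : Finset ι} (he : e ∉ E)
    (W : Submodule ℝ V) :
    signedSpanningCount v (insert e E) W =
      signedSpanningCount v E W - signedSpanningCount v E (W ⊔ Submodule.span ℝ {v e}) := by
  unfold signedSpanningCount
  rw [Finset.sum_powerset_insert he, sub_eq_add_neg, ← Finset.sum_neg_distrib]
  congr 1
  refine Finset.sum_congr rfl fun X hX => ?_
  have heX : e ∉ X := fun h => he (Finset.mem_powerset.1 hX h)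
  rw [span_image_insert_sup, Finset.card_insert_of_notMem heX]
  split_ifs <;> simp [pow_succ]

theorem finrank_span_image_sup_le [FiniteDimensional ℝ V] (v : ι → V) (X : Finset ι)
    (W : Submodule ℝ V) :
    Module.finrank ℝ ↥(Submodule.span ℝ (v '' ↑X) ⊔ W) ≤ X.card + Module.finrank ℝ W := by
  refine (Submodule.finrank_add_le_finrank_add_finrank _ _).trans ?_
  gcongr
  rw [← Finset.coe_image]
  exact (finrank_span_finset_le_card _).trans Finset.card_image_le

theorem spanning_insert_iff (v : ι → V) {e : ι} {E : Finset ι} (he : e ∉ E)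
    (W : Submodule ℝ V) (c : ℕ) :
    (∀ X ⊆ insert e E, X.card = c + 1 → Submodule.span ℝ (v '' ↑X) ⊔ W = ⊤) ↔
      (∀ X ⊆ E, X.card = c + 1 → Submodule.span ℝ (v '' ↑X) ⊔ W = ⊤) ∧
      (∀ X ⊆ E, X.card = c →
        Submodule.span ℝ (v '' ↑X) ⊔ (W ⊔ Submodule.span ℝ {v e}) = ⊤) := by
  constructor
  · intro h
    refine ⟨fun X hX hc => h X (hX.trans (Finset.subset_insert _ _)) hc, fun X hX hc => ?_⟩
    rw [← span_image_insert_sup]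
    refine h _ (Finset.insert_subset_insert _ hX) ?_
    rw [Finset.card_insert_of_notMem fun h => he (hX h), hc]
  · rintro ⟨h₁, h₂⟩ X hX hc
    by_cases heX : e ∈ X
    · rw [← Finset.insert_erase heX, span_image_insert_sup]
      refine h₂ _ (Finset.subset_insert_iff.1 hX) ?_
      rw [Finset.card_erase_of_mem heX, hc, Nat.add_sub_cancel]
    · exact h₁ X ((Finset.subset_insert_iff_of_notMem heX).1 hX) hc

theorem signedSpanningCount_bounds [FiniteDimensional ℝ V] (v : ι → V) (E : Finset ι) :
    ∀ (W : Submodule ℝ V) (c : ℕ), Module.finrank ℝ W + c = Module.finrank ℝ V →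
      0 ≤ (-1) ^ c * signedSpanningCount v E W ∧
      (-1) ^ c * signedSpanningCount v E W ≤ compositionCount E.card c ∧
      ((-1) ^ c * signedSpanningCount v E W = compositionCount E.card c ↔
        ∀ X ⊆ E, X.card = c → Submodule.span ℝ (v '' ↑X) ⊔ W = ⊤) := by
  induction E using Finset.induction_on with
  | empty =>
    intro W c hc
    rcases c with _ | c
    · have hW : W = ⊤ := Submodule.eq_top_of_finrank_eq hc
      simp [signedSpanningCount, compositionCount, hW]
    · have hW : W ≠ ⊤ := by
        rintro rfl
        rw [finrank_top] at hc
        omega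
      simp [signedSpanningCount, compositionCount, hW]
  | insert e E he ih =>
    intro W c hc
    rw [signedSpanningCount_insert v he, Finset.card_insert_of_notMem he]
    by_cases hW : v e ∈ W
    · have hle : W ⊔ Submodule.span ℝ {v e} = W := by simpa using hW
      rw [hle, sub_self, mul_zero]
      refine ⟨le_rfl, Int.natCast_nonneg _, ?_⟩
      rcases c with _ | c
      · have hW : W = ⊤ := Submodule.eq_top_of_finrank_eq hc
        simp [compositionCount, hW]
      · rw [eq_comm, Nat.cast_eq_zero, compositionCount, Nat.choose_eq_zero_iff]
        constructor
        · intro hlt X hX hXc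
          have := Finset.card_le_card hX
          rw [Finset.card_insert_of_notMem he] at this
          omega
        · intro h
          by_contra! hlt
          obtain ⟨X, hX, hXc⟩ := Finset.exists_subset_card_eq hlt
          have htop := ((spanning_insert_iff v he W c).1 h).2 X hX hXc
          have hle' := finrank_span_image_sup_le v X (W ⊔ Submodule.span ℝ {v e})
          rw [htop, hle, finrank_top] at hle'
          omega
    · have hlt : W < W ⊔ Submodule.span ℝ {v e} := by simpa [left_lt_sup] using hW
      have hr₁ := Submodule.finrank_lt_finrank_of_lt hlt
      have hr₂ := Submodule.finrank_add_le_finrank_add_finrank W (Submodule.span ℝ {v e})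
      have hr₃ := finrank_span_le_card (R := ℝ) ({v e} : Set V)
      have hr₄ := Submodule.finrank_le (W ⊔ Submodule.span ℝ {v e})
      rw [Set.toFinset_singleton, Finset.card_singleton] at hr₃
      obtain ⟨c, rfl⟩ : ∃ k, c = k + 1 := ⟨c - 1, by omega⟩
      obtain ⟨a₁, a₂, a₃⟩ := ih W (c + 1) hc
      obtain ⟨b₁, b₂, b₃⟩ := ih (W ⊔ Submodule.span ℝ {v e}) c (by omega)
      rw [spanning_insert_iff v he, ← a₃, ← b₃, compositionCount_succ_succ, mul_sub]
      generalize signedSpanningCount v E W = s at *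
      generalize signedSpanningCount v E _ = t at *
      have ht : (-1) ^ (c + 1) * t = -((-1) ^ c * t) := by ring
      rw [ht]
      push_cast
      generalize (-1) ^ (c + 1) * s = s' at *
      generalize (-1) ^ c * t = t' at *
      clear a₃ b₃ ih
      refine ⟨by omega, by omega, by omega⟩

end Spanning

/-- The smallest flat containing `X`. -/
noncomputable def flatClosure {d n : ℕ} (A : Matrix (Fin d) (Fin n) ℝ) (X : Finset (Fin n)) :
    Finset (Fin n) :=
  Finset.univ.filter fun i => matCol A i ∈ Submodule.span ℝ (matCol A '' ↑X)

section Flats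

variable {d n : ℕ} (A : Matrix (Fin d) (Fin n) ℝ)

theorem mem_flatClosure {X : Finset (Fin n)} {i : Fin n} :
    i ∈ flatClosure A X ↔ matCol A i ∈ Submodule.span ℝ (matCol A '' ↑X) := by
  simp [flatClosure]

theorem subset_flatClosure (X : Finset (Fin n)) : X ⊆ flatClosure A X := fun i hi =>
  (mem_flatClosure A).2 (Submodule.subset_span ⟨i, hi, rfl⟩)

theorem span_flatClosure (X : Finset (Fin n)) :
    Submodule.span ℝ (matCol A '' ↑(flatClosure A X)) = Submodule.span ℝ (matCol A '' ↑X) := by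
  apply le_antisymm
  · rw [Submodule.span_le]
    rintro _ ⟨i, hi, rfl⟩
    exact (mem_flatClosure A).1 hi
  · exact Submodule.span_mono (Set.image_mono (subset_flatClosure A X))

theorem isFlat_flatClosure (X : Finset (Fin n)) : IsFlat A (flatClosure A X) := fun i => by
  rw [span_flatClosure, mem_flatClosure]

theorem flatClosure_subset {X H : Finset (Fin n)} (hH : IsFlat A H) (h : X ⊆ H) :
    flatClosure A X ⊆ H := fun i hi =>
  (hH i).2 (Submodule.span_mono (Set.image_mono h) ((mem_flatClosure A).1 hi))

theorem isFlat_empty (hcol : ∀ j, matCol A j ≠ 0) : IsFlat A ∅ := fun i => by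
  simp [hcol i]

theorem isFlat_univ : IsFlat A Finset.univ := fun i => by
  simpa using Submodule.subset_span (Set.mem_range_self i)

theorem sum_flats_sum_flatClosure_eq {H : Finset (Fin n)} (hH : IsFlat A H) :
    ∑ G ∈ H.powerset.filter (fun G => IsFlat A G ∧ ∅ ⊆ G),
      ∑ X ∈ Finset.univ.filter (fun X => flatClosure A X = G), (-1 : ℤ) ^ X.card =
    ∑ X ∈ H.powerset, (-1 : ℤ) ^ X.card := by
  rw [← Finset.sum_fiberwise_of_maps_to (g := flatClosure A) (s := H.powerset)
    (t := H.powerset.filter (fun G => IsFlat A G ∧ ∅ ⊆ G))]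
  · refine Finset.sum_congr rfl fun G hG => Finset.sum_congr ?_ fun _ _ => rfl
    ext X
    simp only [Finset.mem_filter, Finset.mem_univ, true_and, Finset.mem_powerset] at hG ⊢
    refine ⟨fun h => ⟨?_, h⟩, fun h => h.2⟩
    exact (subset_flatClosure A X).trans (h ▸ hG.1)
  · intro X hX
    simp only [Finset.mem_filter, Finset.mem_powerset] at hX ⊢
    exact ⟨flatClosure_subset A hH hX, isFlat_flatClosure A X, Finset.empty_subset _⟩

/-- Rota's formula for the Möbius function of the lattice of flats. -/
theorem moebius_eq_sum_flatClosure (hcol : ∀ j, matCol A j ≠ 0)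
    (μ : Finset (Fin n) → Finset (Fin n) → ℤ) (hrefl : ∀ F, IsFlat A F → μ F F = 1)
    (hsum : ∀ F H, IsFlat A F → IsFlat A H → F ⊂ H →
      ∑ G ∈ H.powerset.filter (fun G => IsFlat A G ∧ F ⊆ G), μ F G = 0)
    (H : Finset (Fin n)) (hH : IsFlat A H) :
    μ ∅ H = ∑ X ∈ Finset.univ.filter (fun X => flatClosure A X = H), (-1 : ℤ) ^ X.card := by
  induction H using Finset.strongInduction with
  | H H ih =>
    have hmem : H ∈ H.powerset.filter (fun G => IsFlat A G ∧ ∅ ⊆ G) := by simp [hH]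
    have key : ∑ G ∈ H.powerset.filter (fun G => IsFlat A G ∧ ∅ ⊆ G), μ ∅ G =
        ∑ X ∈ H.powerset, (-1 : ℤ) ^ X.card := by
      rw [Finset.sum_powerset_neg_one_pow_card]
      split_ifs with h
      · subst h
        rw [Finset.powerset_empty, Finset.filter_singleton, if_pos ⟨hH, subset_rfl⟩,
          Finset.sum_singleton, hrefl _ hH]
      · exact hsum ∅ H (isFlat_empty A hcol) hH (Finset.empty_ssubset.2
          (Finset.nonempty_iff_ne_empty.2 h))
    rw [← sum_flats_sum_flatClosure_eq A hH, ← Finset.add_sum_erase _ _ hmem,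
      ← Finset.add_sum_erase _ _ hmem] at key
    rw [Finset.sum_congr rfl fun G hG => ?_] at key
    · exact add_right_cancel key
    · simp only [Finset.mem_erase, Finset.mem_filter, Finset.mem_powerset] at hG
      exact ih G (hG.2.1.ssubset_of_ne hG.1) hG.2.2.1

theorem span_matCol_eq_top (hrank : A.rank = d) :
    Submodule.span ℝ (Set.range (matCol A)) = ⊤ := by
  apply Submodule.eq_top_of_finrank_eq
  have h := A.rank_eq_finrank_span_cols
  rw [hrank] at h
  rw [Module.finrank_fin_fun]
  exact h.symm

theorem flatClosure_eq_univ_iff (hrank : A.rank = d) (X : Finset (Fin n)) :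
    flatClosure A X = Finset.univ ↔ Submodule.span ℝ (matCol A '' ↑X) = ⊤ := by
  constructor
  · intro h
    rw [← span_flatClosure, h, Finset.coe_univ, Set.image_univ, span_matCol_eq_top A hrank]
  · intro h
    ext i
    simp [mem_flatClosure, h]

theorem span_matCol_eq_top_iff_linearIndependent {I : Finset (Fin n)} (hI : I.card = d) :
    Submodule.span ℝ (matCol A '' ↑I) = ⊤ ↔
      LinearIndependent ℝ (fun i : ↥I => matCol A i) := by
  have hrange : Set.range (fun i : ↥I => matCol A i) = matCol A '' ↑I := by
    ext x
    simp
  have hcard : Fintype.card ↥I = Module.finrank ℝ (Fin d → ℝ) := by simp [hI]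
  rw [← hrange]
  constructor
  · exact fun h => linearIndependent_of_top_le_span_of_card_eq_finrank h.ge hcard
  · exact fun h => h.span_eq_top_of_card_eq_finrank' hcard

end Flats

/-- The Möbius invariant satisfies `μ(A) ≤ C(n−1, d−1)`, with equality iff every `d`
columns of `A` are linearly independent (the matroid of `A` is uniform). -/
theorem stmt_8 {d n : ℕ} (A : Matrix (Fin d) (Fin n) ℝ)
    (hrank : A.rank = d) (hcol : ∀ j, matCol A j ≠ 0)
    (μ : Finset (Fin n) → Finset (Fin n) → ℤ)
    (hrefl : ∀ F, IsFlat A F → μ F F = 1)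
    (hsum : ∀ F H, IsFlat A F → IsFlat A H → F ⊂ H →
      ∑ G ∈ H.powerset.filter (fun G => IsFlat A G ∧ F ⊆ G), μ F G = 0) :
    (μ ∅ Finset.univ).natAbs ≤ (n - 1).choose (d - 1) ∧
    ((μ ∅ Finset.univ).natAbs = (n - 1).choose (d - 1) ↔
      ∀ I : Finset (Fin n), I.card = d →
        LinearIndependent ℝ (fun i : ↥I => matCol A i)) := by
  have hμ : μ ∅ Finset.univ = signedSpanningCount (matCol A) Finset.univ ⊥ := by
    rw [moebius_eq_sum_flatClosure A hcol μ hrefl hsum _ (isFlat_univ A), Finset.sum_filter,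
      signedSpanningCount, Finset.powerset_univ]
    simp only [flatClosure_eq_univ_iff A hrank, sup_bot_eq]
  have hcount : compositionCount n d = (n - 1).choose (d - 1) := by
    have hdn : d ≤ n := hrank ▸ A.rank_le_width
    rcases d with _ | d
    · rcases n with _ | n
      · rfl
      · exact absurd (Subsingleton.elim _ _) (hcol 0)
    · obtain ⟨n, rfl⟩ : ∃ k, n = k + 1 := ⟨n - 1, by omega⟩
      rfl
  obtain ⟨h₁, h₂, h₃⟩ := signedSpanningCount_bounds (matCol A) Finset.univ ⊥ d (by simp)
  rw [← hμ, Finset.card_univ, Fintype.card_fin, hcount] at h₂ h₃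
  rw [← hμ] at h₁
  have habs : ((μ ∅ Finset.univ).natAbs : ℤ) = (-1) ^ d * μ ∅ Finset.univ := by
    rw [Int.natCast_natAbs, ← abs_of_nonneg h₁, abs_mul, abs_pow, abs_neg, abs_one, one_pow,
      one_mul]
  refine ⟨by exact_mod_cast habs.trans_le h₂, ?_⟩
  rw [← Nat.cast_inj (R := ℤ), habs, h₃]
  simp only [Finset.subset_univ, true_imp_iff, sup_bot_eq]
  exact forall₂_congr fun I hI => span_matCol_eq_top_iff_linearIndependent A hI
end
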